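/- Let α > 0 and −α−1 < β < −1 with −β ∉ ℕ, and let m, N ∈ ℕ with 0 ≤ m ≤ N and N ≥ 1. Suppose D_+^α u ∈ L²_{ω^{(0,α+β)}}(Λ) with Jacobi expansion D_+^α u = Σ_{n≥0} v̂_n P_n^{(0,α+β)} converging in L²_{ω^{(0,α+β)}}(Λ), where v̂_n = (1/γ_n^{(0,α+β)}) ∫_{−1}^{1} D_+^α u(x) P_n^{(0,α+β)}(x) ω^{(0,α+β)}(x) dx. Suppose further that D_+^{α+m} u = (−1)^m (d/dx)^m (D_+^α u) belongs to L²_{ω^{(m,α+β+m)}}(Λ) and equals the m-times term-by-term differentiated series, converging in L²_{ω^{(m,α+β+m)}}(Λ). Define π_N u = Σ_{n=0}^{N} [n! v̂_n / Γ(n+α+1)] ^+J_n^{(−α,β)}. Then ‖D_+^α(π_N u − u)‖_{ω^{(0,α+β)}} ≤ N^{−m/2} · √((N−m+1)!/(N+1)!) · ‖D_+^{α+m} u‖_{ω^{(m,α+β+m)}}. -/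

import Mathlib

open MeasureTheory Filter Finset

/-- Jacobi polynomial with real parameters. -/
noncomputable def jacobiP (a b : ℝ) (n : ℕ) (x : ℝ) : ℝ :=
  ∑ j ∈ Finset.range (n + 1),
    ((ascPochhammer ℝ j).eval ((n : ℝ) + a + b + 1) / (Nat.factorial j : ℝ)) *
      ((ascPochhammer ℝ (n - j)).eval (a + (j : ℝ) + 1) / (Nat.factorial (n - j) : ℝ)) *
      ((x - 1) / 2) ^ j

/-- Right Riemann-Liouville fractional integral on (-1,1). -/
noncomputable def Iplus (ρ : ℝ) (v : ℝ → ℝ) (x : ℝ) : ℝ :=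
  (1 / Real.Gamma ρ) * ∫ y in x..1, (y - x) ^ (ρ - 1) * v y

/-- Left Riemann-Liouville fractional integral on (-1,1). -/
noncomputable def Iminus (ρ : ℝ) (v : ℝ → ℝ) (x : ℝ) : ℝ :=
  (1 / Real.Gamma ρ) * ∫ y in (-1 : ℝ)..x, (x - y) ^ (ρ - 1) * v y

/-- Right Riemann-Liouville fractional derivative of order `s ∈ [k-1,k)`. -/
noncomputable def Dplus (s : ℝ) (k : ℕ) (v : ℝ → ℝ) (x : ℝ) : ℝ :=
  (-1 : ℝ) ^ k * iteratedDeriv k (Iplus ((k : ℝ) - s) v) x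

/-- Left Riemann-Liouville fractional derivative of order `s ∈ [k-1,k)`. -/
noncomputable def Dminus (s : ℝ) (k : ℕ) (v : ℝ → ℝ) (x : ℝ) : ℝ :=
  iteratedDeriv k (Iminus ((k : ℝ) - s) v) x

/-- Right RL fractional derivative with the canonical `k = ⌊s⌋ + 1` (so `s ∈ [k-1,k)`
for any `s ≥ 0`). -/
noncomputable def DplusC (s : ℝ) (v : ℝ → ℝ) (x : ℝ) : ℝ :=
  Dplus s (⌊s⌋.toNat + 1) v x

/-- Normalization constant γ_n^{(a,b)}. -/
noncomputable def gammaJ (a b : ℝ) (n : ℕ) : ℝ :=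
  (2 : ℝ) ^ (a + b + 1) * Real.Gamma ((n : ℝ) + a + 1) * Real.Gamma ((n : ℝ) + b + 1) /
    ((2 * (n : ℝ) + a + b + 1) * (Nat.factorial n : ℝ) * Real.Gamma ((n : ℝ) + a + b + 1))


lemma jf_freq_deriv {f : ℝ → ℝ} {x : ℝ} (h : ∃ᶠ y in nhdsWithin x {x}ᶜ, f y = 0) :
    ∃ᶠ y in nhdsWithin x {x}ᶜ, deriv f y = 0 := by
  have rolle : ∀ a b : ℝ, a < b → f a = 0 → f b = 0 → ∃ z ∈ Set.Icc a b, deriv f z = 0 := by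
    intro a b hab ha hb
    by_cases hc : ContinuousOn f (Set.Icc a b)
    · obtain ⟨c, hc1, hc2⟩ := exists_deriv_eq_zero hab hc (ha.trans hb.symm)
      exact ⟨c, Set.Ioo_subset_Icc_self hc1, hc2⟩
    · simp only [ContinuousOn, not_forall] at hc
      obtain ⟨z, hz, hz2⟩ := hc
      refine ⟨z, hz, deriv_zero_of_not_differentiableAt ?_⟩
      intro hd
      exact hz2 hd.continuousAt.continuousWithinAt
  rw [← Set.Iio_union_Ioi, nhdsWithin_union, frequently_sup] at h ⊢
  rcases h with h | h
  · left
    rw [(nhdsLT_basis x).frequently_iff] at h ⊢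
    intro i hi
    obtain ⟨a, ha, ha2⟩ := h i hi
    obtain ⟨b, hb, hb2⟩ := h a ha.2
    obtain ⟨z, hz, hz2⟩ := rolle a b hb.1 ha2 hb2
    exact ⟨z, ⟨lt_of_lt_of_le ha.1 hz.1, lt_of_le_of_lt hz.2 hb.2⟩, hz2⟩
  · right
    rw [(nhdsGT_basis x).frequently_iff] at h ⊢
    intro i hi
    obtain ⟨a, ha, ha2⟩ := h i hi
    obtain ⟨b, hb, hb2⟩ := h a ha.1
    obtain ⟨z, hz, hz2⟩ := rolle b a hb.2 hb2 ha2
    exact ⟨z, ⟨lt_of_lt_of_le hb.1 hz.1, lt_of_le_of_lt hz.2 ha.2⟩, hz2⟩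

lemma jf_freq_iter (k : ℕ) : ∀ {f : ℝ → ℝ} {x : ℝ}, (∃ᶠ y in nhdsWithin x {x}ᶜ, f y = 0) →
    iteratedDeriv (k + 1) f x = 0 := by
  induction k with
  | zero => intro f x h; simpa using deriv_zero_of_frequently_const h
  | succ k ih =>
    intro f x h
    rw [iteratedDeriv_succ']
    exact ih (jf_freq_deriv h)

/-- Junk-proof linearity of iterated derivatives up to countable sets. -/
lemma jf_main (k : ℕ) : ∀ (f g p : ℝ → ℝ) (U : Set ℝ), IsOpen U → ContDiff ℝ (⊤ : ℕ∞) p →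
    (∀ x ∈ U, g x = p x - f x ∨ (f x = 0 ∧ g x = 0)) →
    ∃ C : Set ℝ, C.Countable ∧ ∀ x ∈ U, x ∉ C →
      (iteratedDeriv k g x = iteratedDeriv k p x - iteratedDeriv k f x ∨
        (iteratedDeriv k f x = 0 ∧ iteratedDeriv k g x = 0)) := by
  induction k with
  | zero =>
    intro f g p U hU hp h
    exact ⟨∅, Set.countable_empty, fun x hx _ => by simpa using h x hx⟩
  | succ k ih =>
    intro f g p U hU hp h
    set S : Set ℝ := {x | f x = 0 ∧ g x = 0} with hS
    set V : Set ℝ := U \ closure S with hV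
    have hVo : IsOpen V := hU.sdiff isClosed_closure
    have hpd : Differentiable ℝ p := hp.differentiable (by simp)
    have hp' : ContDiff ℝ (⊤ : ℕ∞) (deriv p) := by
      have := (contDiff_infty_iff_deriv (𝕜 := ℝ) (f := p)).1 hp
      exact this.2
    have hVg : ∀ x ∈ V, g x = p x - f x := by
      intro x hx
      rcases h x hx.1 with h1 | h1
      · exact h1
      · exact absurd (subset_closure (show x ∈ S from h1)) hx.2
    obtain ⟨C, hC, hC2⟩ := ih (deriv f) (deriv g) (deriv p) V hVo hp' (by
      intro x hx
      have hev : g =ᶠ[nhds x] fun y => p y - f y :=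
        Filter.eventually_of_mem (hVo.mem_nhds hx) hVg
      have hev' : f =ᶠ[nhds x] fun y => p y - g y := by
        filter_upwards [hev] with y hy
        rw [hy]; ring
      by_cases hf : DifferentiableAt ℝ f x
      · left
        rw [hev.deriv_eq]
        exact deriv_fun_sub (hpd x) hf
      · right
        refine ⟨deriv_zero_of_not_differentiableAt hf, deriv_zero_of_not_differentiableAt ?_⟩
        intro hg
        exact hf (((hpd x).sub hg).congr_of_eventuallyEq hev'))
    refine ⟨C ∪ {x ∈ S | nhdsWithin x (S ∩ Set.Ioi x) = ⊥},
      hC.union countable_setOfPred_isolated_right_within, ?_⟩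
    intro x hx hxC
    by_cases hxV : x ∈ V
    · simp only [iteratedDeriv_succ']
      exact hC2 x hxV (fun h => hxC (Or.inl h))
    · have hcl : x ∈ closure S := by
        by_contra h'
        exact hxV ⟨hx, h'⟩
      have hfr : ∃ᶠ y in nhdsWithin x {x}ᶜ, y ∈ S := by
        by_cases hxS : x ∈ S
        · intro hno
          apply hxC
          right
          refine ⟨hxS, ?_⟩
          rw [← Filter.eventually_false_iff_eq_bot, eventually_nhdsWithin_iff]
          rw [eventually_nhdsWithin_iff] at hno
          filter_upwards [hno] with y hy hy2
          exact hy (ne_of_gt hy2.2) hy2.1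
        · have := mem_closure_iff_frequently.1 hcl
          rw [frequently_nhdsWithin_iff]
          refine this.mono (fun y hy => ⟨hy, ?_⟩)
          rintro rfl
          exact hxS hy
      right
      exact ⟨jf_freq_iter k (hfr.mono fun y hy => hy.1), jf_freq_iter k (hfr.mono fun y hy => hy.2)⟩

lemma jb_beta {ρ σ a : ℝ} (hρ : 0 < ρ) (hσ : 0 < σ) (ha : 0 < a) :
    ∫ t in (0:ℝ)..a, t ^ (ρ - 1) * (a - t) ^ (σ - 1) =
      a ^ (ρ + σ - 1) * (Real.Gamma ρ * Real.Gamma σ / Real.Gamma (ρ + σ)) := by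
  apply Complex.ofReal_injective
  rw [← intervalIntegral.integral_ofReal]
  have h := Complex.betaIntegral_scaled (ρ : ℂ) (σ : ℂ) ha
  rw [Complex.betaIntegral_eq_Gamma_mul_div _ _ (by simpa) (by simpa)] at h
  have e : ((a ^ (ρ + σ - 1) * (Real.Gamma ρ * Real.Gamma σ / Real.Gamma (ρ + σ)) : ℝ) : ℂ) =
    (a:ℂ) ^ ((ρ:ℂ) + σ - 1) * (Complex.Gamma ρ * Complex.Gamma σ / Complex.Gamma (ρ + σ)) := by
    push_cast
    rw [Complex.ofReal_cpow ha.le, ← Complex.ofReal_add ρ σ, Complex.Gamma_ofReal,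
      Complex.Gamma_ofReal, Complex.Gamma_ofReal]
    push_cast
    rfl
  rw [e, ← h]
  apply intervalIntegral.integral_congr
  intro t ht
  rw [Set.uIcc_of_le ha.le] at ht
  simp only
  rw [Complex.ofReal_mul, Complex.ofReal_cpow ht.1, Complex.ofReal_cpow (sub_nonneg.2 ht.2)]
  push_cast
  rfl

lemma jb_int {ρ α x : ℝ} (j : ℕ) (hρ : 0 < ρ) (hα : 0 < α) :
    IntervalIntegrable (fun y => (y - x) ^ (ρ - 1) * ((1 - y) ^ α * (1 - y) ^ j)) volume x 1 := by
  have h1 : IntervalIntegrable (fun y : ℝ => y ^ (ρ - 1)) volume 0 (1 - x) :=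
    intervalIntegral.intervalIntegrable_rpow' (by linarith)
  have h2 := h1.comp_sub_right x
  simp only [zero_add, sub_add_cancel] at h2
  refine h2.mul_continuousOn ?_
  apply Continuous.continuousOn
  have : Continuous fun y : ℝ => (1 - y) ^ α :=
    (continuous_const.sub continuous_id).rpow_const (fun _ => Or.inr hα.le)
  fun_prop

lemma jb_val {ρ α x : ℝ} (j : ℕ) (hρ : 0 < ρ) (hα : 0 < α) (hx : x < 1) :
    ∫ y in x..1, (y - x) ^ (ρ - 1) * ((1 - y) ^ α * (1 - y) ^ j) =
      (1 - x) ^ (ρ + α + j) * (Real.Gamma ρ * Real.Gamma (α + j + 1) /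
        Real.Gamma (ρ + α + j + 1)) := by
  have h := jb_beta (σ := α + j + 1) (a := 1 - x) hρ (by positivity) (by linarith)
  have h2 := intervalIntegral.integral_comp_sub_right (a := x) (b := 1)
    (fun t : ℝ => t ^ (ρ - 1) * ((1 - x) - t) ^ (α + j + 1 - 1)) x
  rw [sub_self, h] at h2
  have e1 : ρ + (α + j + 1) - 1 = ρ + α + j := by ring
  have e2 : ρ + (α + j + 1) = ρ + α + j + 1 := by ring
  rw [e1, e2] at h2
  rw [← h2]
  apply intervalIntegral.integral_congr
  intro y hy
  rw [Set.uIcc_of_le hx.le] at hy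
  simp only
  have e3 : 1 - x - (y - x) = 1 - y := by ring
  have e4 : α + j + 1 - 1 = α + j := by ring
  rw [e3, e4, Real.rpow_add_natCast' (by linarith [hy.2]) (by positivity)]

lemma jb_poch {a : ℝ} (n : ℕ) (ha : 0 < a) :
    Real.Gamma a * (ascPochhammer ℝ n).eval a = Real.Gamma (a + n) := by
  induction n with
  | zero => simp
  | succ n ih =>
    rw [ascPochhammer_succ_eval, ← mul_assoc, ih]
    push_cast
    rw [← add_assoc, Real.Gamma_add_one (by positivity)]
    ring

lemma jb_iter (k : ℕ) : ∀ (j : ℕ) (x : ℝ), (-1 : ℝ) ^ k * iteratedDeriv k (fun x : ℝ => (1 - x) ^ (k + j)) x =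
    ((k + j).factorial : ℝ) / (j.factorial : ℝ) * (1 - x) ^ j := by
  induction k with
  | zero => intro j x; simp [Nat.factorial_ne_zero]
  | succ k ih =>
    intro j x
    rw [iteratedDeriv_succ']
    have : deriv (fun x : ℝ => (1 - x) ^ (k + 1 + j)) = fun x => (-((k + 1 + j : ℕ) : ℝ)) * (1 - x) ^ (k + j) := by
      ext x
      have h := ((hasDerivAt_id x).const_sub 1).pow (k + 1 + j)
      have := h.deriv
      simp only [id] at this
      have e : k + 1 + j - 1 = k + j := by omega
      rw [e] at this
      convert! this using 1
      ring
    rw [this, iteratedDeriv_const_mul_field, pow_succ]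
    have h := ih j x
    have e : k + 1 + j = (k + j) + 1 := by omega
    rw [e, Nat.factorial_succ]
    push_cast
    linear_combination ((k:ℝ) + j + 1) * h

noncomputable def jcP (α : ℝ) (k : ℕ) (N : ℕ) (d : ℕ → ℕ → ℝ) (x : ℝ) : ℝ :=
  ∑ n ∈ Finset.range (N + 1), ∑ j ∈ Finset.range (n + 1),
    d n j * (Real.Gamma (α + j + 1) / ((k + j).factorial : ℝ)) * (1 - x) ^ (k + j)

lemma jcP_smooth (α : ℝ) (k N : ℕ) (d : ℕ → ℕ → ℝ) : ContDiff ℝ (⊤ : ℕ∞) (jcP α k N d) := by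
  unfold jcP
  fun_prop

lemma jcP_iter (α : ℝ) (k N : ℕ) (d : ℕ → ℕ → ℝ) (x : ℝ) :
    (-1 : ℝ) ^ k * iteratedDeriv k (jcP α k N d) x =
      ∑ n ∈ Finset.range (N + 1), ∑ j ∈ Finset.range (n + 1),
        d n j * (Real.Gamma (α + j + 1) / (j.factorial : ℝ)) * (1 - x) ^ j := by
  unfold jcP
  rw [iteratedDeriv_fun_sum (by intro i hi; fun_prop), Finset.mul_sum]
  refine Finset.sum_congr rfl fun n _ => ?_
  rw [iteratedDeriv_fun_sum (by intro i hi; fun_prop), Finset.mul_sum]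
  refine Finset.sum_congr rfl fun j _ => ?_
  rw [iteratedDeriv_const_mul_field]
  have h := jb_iter k j x
  have h1 : ((k + j).factorial : ℝ) ≠ 0 := by positivity
  have h2 : (j.factorial : ℝ) ≠ 0 := by positivity
  calc _ = d n j * (Real.Gamma (α + j + 1) / ((k + j).factorial : ℝ)) *
        ((-1 : ℝ) ^ k * iteratedDeriv k (fun x : ℝ => (1 - x) ^ (k + j)) x) := by ring
    _ = _ := by rw [h]; field_simp

lemma jc_Iplus {α : ℝ} {k : ℕ} (hα : 0 < α) (hk : α < k) (N : ℕ) (d : ℕ → ℕ → ℝ) {x : ℝ}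
    (hx : x < 1) :
    IntervalIntegrable (fun y => (y - x) ^ ((k : ℝ) - α - 1) *
      ∑ n ∈ Finset.range (N + 1), ∑ j ∈ Finset.range (n + 1),
        d n j * ((1 - y) ^ α * (1 - y) ^ j)) volume x 1 ∧
    Iplus ((k : ℝ) - α) (fun y => ∑ n ∈ Finset.range (N + 1), ∑ j ∈ Finset.range (n + 1),
        d n j * ((1 - y) ^ α * (1 - y) ^ j)) x = jcP α k N d x := by
  have hρ : 0 < (k : ℝ) - α := by linarith
  have e : (fun y : ℝ => (y - x) ^ ((k : ℝ) - α - 1) *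
      ∑ n ∈ Finset.range (N + 1), ∑ j ∈ Finset.range (n + 1),
        d n j * ((1 - y) ^ α * (1 - y) ^ j)) = fun y =>
      ∑ n ∈ Finset.range (N + 1), ∑ j ∈ Finset.range (n + 1),
        d n j * ((y - x) ^ ((k : ℝ) - α - 1) * ((1 - y) ^ α * (1 - y) ^ j)) := by
    ext y
    simp only [Finset.mul_sum]
    refine Finset.sum_congr rfl fun n _ => Finset.sum_congr rfl fun j _ => ?_
    ring
  have hi : ∀ n j : ℕ, IntervalIntegrable (fun y => d n j * ((y - x) ^ ((k : ℝ) - α - 1) *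
      ((1 - y) ^ α * (1 - y) ^ j))) volume x 1 := fun n j => (jb_int j hρ hα).const_mul _
  have hs : ∀ n : ℕ, IntervalIntegrable (fun y => ∑ j ∈ Finset.range (n + 1),
      d n j * ((y - x) ^ ((k : ℝ) - α - 1) * ((1 - y) ^ α * (1 - y) ^ j))) volume x 1 := by
    intro n
    have := IntervalIntegrable.sum (Finset.range (n + 1)) (fun j _ => hi n j)
    convert! this using 1
    ext y; simp
  constructor
  · rw [e]
    have := IntervalIntegrable.sum (Finset.range (N + 1)) (fun n _ => hs n)
    convert! this using 1
    ext y; simp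
  · unfold Iplus
    rw [e, intervalIntegral.integral_finsetSum (fun n _ => hs n), Finset.mul_sum]
    unfold jcP
    refine Finset.sum_congr rfl fun n _ => ?_
    rw [intervalIntegral.integral_finsetSum (fun j _ => hi n j), Finset.mul_sum]
    refine Finset.sum_congr rfl fun j _ => ?_
    rw [intervalIntegral.integral_const_mul, jb_val j hρ hα hx]
    have e1 : (k : ℝ) - α + α + j = ((k + j : ℕ) : ℝ) := by push_cast; ring
    rw [e1, Real.Gamma_nat_eq_factorial, Real.rpow_natCast]
    have := (Real.Gamma_pos_of_pos hρ).ne'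
    field_simp

lemma jc_main {α β : ℝ} (hα : 0 < α) (N : ℕ) (u : ℝ → ℝ) (vhat : ℕ → ℝ) :
    ∃ C : Set ℝ, C.Countable ∧ ∀ x ∈ Set.Ioo (-1 : ℝ) 1, x ∉ C →
      (DplusC α (fun y => (∑ n ∈ Finset.range (N + 1),
                (Nat.factorial n : ℝ) * vhat n / Real.Gamma ((n : ℝ) + α + 1) *
                  ((1 - y) ^ α * jacobiP α β n y)) - u y) x) ^ 2 ≤
      ((∑ n ∈ Finset.range (N + 1), vhat n * jacobiP 0 (α + β) n x) - DplusC α u x) ^ 2 := by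
  set k : ℕ := ⌊α⌋.toNat + 1 with hkdef
  have hk : α < k := by
    have h1 := Int.lt_floor_add_one α
    have h2 : ((⌊α⌋.toNat : ℤ)) = ⌊α⌋ := Int.toNat_of_nonneg (Int.floor_nonneg.2 hα.le)
    rw [hkdef]
    push_cast
    have h3 : ((⌊α⌋.toNat : ℝ)) = (⌊α⌋ : ℝ) := by exact_mod_cast h2
    rw [h3]; exact h1
  let d : ℕ → ℕ → ℝ := fun n j => (Nat.factorial n : ℝ) * vhat n / Real.Gamma ((n : ℝ) + α + 1) *
    (((ascPochhammer ℝ j).eval ((n : ℝ) + α + β + 1) / (Nat.factorial j : ℝ)) *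
      ((ascPochhammer ℝ (n - j)).eval (α + (j : ℝ) + 1) / (Nat.factorial (n - j) : ℝ)) *
      (-1 / 2) ^ j)
  have hpi : ∀ y : ℝ, (∑ n ∈ Finset.range (N + 1),
      (Nat.factorial n : ℝ) * vhat n / Real.Gamma ((n : ℝ) + α + 1) *
      ((1 - y) ^ α * jacobiP α β n y)) = ∑ n ∈ Finset.range (N + 1), ∑ j ∈ Finset.range (n + 1),
        d n j * ((1 - y) ^ α * (1 - y) ^ j) := by
    intro y
    refine Finset.sum_congr rfl fun n _ => ?_
    unfold jacobiP
    simp only [Finset.mul_sum]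
    refine Finset.sum_congr rfl fun j _ => ?_
    have : ((y - 1) / 2) ^ j = (-1 / 2) ^ j * (1 - y) ^ j := by
      rw [← mul_pow]; congr 1; ring
    rw [this]
    simp only [d]
    ring
  have hP : ∀ x, (-1 : ℝ) ^ k * iteratedDeriv k (jcP α k N d) x =
      ∑ n ∈ Finset.range (N + 1), vhat n * jacobiP 0 (α + β) n x := by
    intro x
    rw [jcP_iter]
    refine Finset.sum_congr rfl fun n _ => ?_
    unfold jacobiP
    simp only [Finset.mul_sum]
    refine Finset.sum_congr rfl fun j hj => ?_
    have hjn : j ≤ n := by simp at hj; omega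
    have : ((x - 1) / 2) ^ j = (-1 / 2) ^ j * (1 - x) ^ j := by
      rw [← mul_pow]; congr 1; ring
    rw [this]
    simp only [d]
    have c : ((n - j : ℕ) : ℝ) = n - j := by push_cast [hjn]; ring
    have g1 := jb_poch (a := α + j + 1) (n - j) (by positivity)
    have g2 := jb_poch (a := 0 + (j : ℝ) + 1) (n - j) (by positivity)
    have a1 : α + j + 1 + ((n - j : ℕ) : ℝ) = n + α + 1 := by rw [c]; ring
    have a2 : 0 + (j : ℝ) + 1 + ((n - j : ℕ) : ℝ) = n + 1 := by rw [c]; ring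
    have a3 : Real.Gamma (0 + (j : ℝ) + 1) = j.factorial := by
      rw [zero_add, Real.Gamma_nat_eq_factorial]
    rw [a1] at g1
    rw [a2, Real.Gamma_nat_eq_factorial, a3] at g2
    have a4 : (n : ℝ) + α + β + 1 = n + 0 + (α + β) + 1 := by ring
    rw [a4]
    have hG : Real.Gamma ((n : ℝ) + α + 1) ≠ 0 := (Real.Gamma_pos_of_pos (by positivity)).ne'
    have h2 : (j.factorial : ℝ) ≠ 0 := by positivity
    have h3 : ((n - j).factorial : ℝ) ≠ 0 := by positivity
    rw [← g2]
    field_simp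
    rw [← g1]
    ring
  obtain ⟨C, hC, hC2⟩ := jf_main k (Iplus ((k : ℝ) - α) u)
    (Iplus ((k : ℝ) - α) (fun y => (∑ n ∈ Finset.range (N + 1),
                (Nat.factorial n : ℝ) * vhat n / Real.Gamma ((n : ℝ) + α + 1) *
                  ((1 - y) ^ α * jacobiP α β n y)) - u y)) (jcP α k N d) (Set.Ioo (-1 : ℝ) 1)
    isOpen_Ioo (jcP_smooth _ _ _ _) (by
      intro x hx
      obtain ⟨i1, i2⟩ := jc_Iplus hα hk N d hx.2
      simp only [hpi]
      by_cases hu : IntervalIntegrable (fun y => (y - x) ^ ((k : ℝ) - α - 1) * u y) volume x 1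
      · left
        rw [← i2]
        unfold Iplus
        simp only [mul_sub]
        rw [intervalIntegral.integral_sub i1 hu, mul_sub]
      · right
        unfold Iplus
        rw [intervalIntegral.integral_undef hu, intervalIntegral.integral_undef]
        · simp
        · intro hh
          apply hu
          have := i1.sub hh
          convert! this using 1
          ext y
          ring)
  refine ⟨C, hC, fun x hx hxC => ?_⟩
  rw [← hP]
  unfold DplusC Dplus
  rw [← hkdef]
  rcases hC2 x hx hxC with h | ⟨h1, h2⟩
  · rw [h, mul_sub]
  · rw [h2]
    rw [mul_zero, zero_pow two_ne_zero]
    positivity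

noncomputable def jdc (b : ℝ) (n j : ℕ) : ℝ :=
  (ascPochhammer ℝ j).eval ((n : ℝ) + b + 1) * (n.choose j : ℝ) / (j.factorial : ℝ)

lemma jdc_rec (b : ℝ) (n j : ℕ) : ((j : ℝ) + 1) * (((j : ℝ) + 1) * jdc b n (j + 1)) =
    ((n : ℝ) - j) * (n + j + b + 1) * jdc b n j := by
  unfold jdc
  have h := Nat.choose_succ_right_eq n j
  have h' : (n.choose (j + 1) : ℝ) * (j + 1) = n.choose j * ((n : ℝ) - j) := by
    rcases le_or_gt j n with hj | hj
    · have : ((n.choose (j + 1) * (j + 1) : ℕ) : ℝ) = ((n.choose j * (n - j) : ℕ) : ℝ) := by rw [h]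
      push_cast [hj] at this
      exact this
    · rw [Nat.choose_eq_zero_of_lt hj, Nat.choose_eq_zero_of_lt (by omega)]; simp
  rw [ascPochhammer_succ_eval, Nat.factorial_succ]
  push_cast
  have h2 : (j.factorial : ℝ) ≠ 0 := by positivity
  have h3 : (j : ℝ) + 1 ≠ 0 := by positivity
  field_simp
  linear_combination (Polynomial.eval ((n : ℝ) + b + 1) (ascPochhammer ℝ j)) * ((n : ℝ) + b + 1 + j) * h'

open Polynomial in
noncomputable def jdQ (b : ℝ) (n : ℕ) : ℝ[X] :=
  ∑ j ∈ Finset.range (n + 1), C (jdc b n j) * X ^ j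

lemma jdQ_coeff (b : ℝ) (n j : ℕ) : (jdQ b n).coeff j = jdc b n j := by
  unfold jdQ
  simp only [Polynomial.finsetSum_coeff, Polynomial.coeff_C_mul, Polynomial.coeff_X_pow]
  simp only [mul_ite, mul_one, mul_zero, Finset.sum_ite_eq, Finset.mem_range]
  split_ifs with h
  · rfl
  · unfold jdc
    rw [Nat.choose_eq_zero_of_lt (by omega)]; simp

open Polynomial in
lemma jdQ_ode (b : ℝ) (n : ℕ) :
    derivative (X * derivative (jdQ b n)) + X * derivative (X * derivative (jdQ b n)) +
      C (b + 1) * (X * derivative (jdQ b n)) = C ((n : ℝ) * (n + b + 1)) * jdQ b n := by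
  have key : ∀ (q : ℝ[X]) (j : ℕ), (X * derivative q).coeff j = (j : ℝ) * q.coeff j := by
    intro q j
    cases j with
    | zero => simp
    | succ j => rw [coeff_X_mul, coeff_derivative]; push_cast; ring
  ext j
  rw [coeff_add, coeff_add, coeff_C_mul, coeff_C_mul, key, key, coeff_derivative, key,
    jdQ_coeff, jdQ_coeff]
  have := jdc_rec b n j
  push_cast
  linear_combination this

open Polynomial in
noncomputable def jdP (b : ℝ) (n : ℕ) : ℝ[X] := (jdQ b n).comp (C (1 / 2) * (X - 1))

lemma jdP_eval (b : ℝ) (n : ℕ) (x : ℝ) : (jdP b n).eval x = jacobiP 0 b n x := by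
  unfold jdP jdQ jacobiP
  rw [Polynomial.eval_comp, Polynomial.eval_finsetSum]
  refine Finset.sum_congr rfl fun j hj => ?_
  have hjn : j ≤ n := by simp at hj; omega
  have c : ((n - j : ℕ) : ℝ) = n - j := by push_cast [hjn]; ring
  have g2 := jb_poch (a := 0 + (j : ℝ) + 1) (n - j) (by positivity)
  have a2 : 0 + (j : ℝ) + 1 + ((n - j : ℕ) : ℝ) = n + 1 := by rw [c]; ring
  have a3 : Real.Gamma (0 + (j : ℝ) + 1) = j.factorial := by
    rw [zero_add, Real.Gamma_nat_eq_factorial]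
  rw [a2, Real.Gamma_nat_eq_factorial, a3] at g2
  have h2 : (j.factorial : ℝ) ≠ 0 := by positivity
  have h3 : ((n - j).factorial : ℝ) ≠ 0 := by positivity
  have h4 : (n.choose j : ℝ) * j.factorial * (n - j).factorial = n.factorial := by
    exact_mod_cast Nat.choose_mul_factorial_mul_factorial hjn
  have h5 : (n.choose j : ℝ) =
      (ascPochhammer ℝ (n - j)).eval (0 + (j : ℝ) + 1) / ((n - j).factorial : ℝ) := by
    rw [eq_div_iff h3]
    apply mul_left_cancel₀ h2
    rw [g2, ← h4]; ring
  simp only [Polynomial.eval_mul, Polynomial.eval_C, Polynomial.eval_pow, Polynomial.eval_X,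
    Polynomial.eval_sub, Polynomial.eval_one]
  rw [← h5]
  unfold jdc
  have e1 : 1 / 2 * (x - 1) = (x - 1) / 2 := by ring
  have e2 : (n : ℝ) + 0 + b + 1 = n + b + 1 := by ring
  rw [e1, e2]
  ring

open Polynomial in
lemma jdP_ode (b : ℝ) (n m : ℕ) :
    (1 - X ^ 2) * derivative^[m + 2] (jdP b n) +
      (C b - (2 * (m : ℝ[X]) + C b + 2) * X) * derivative^[m + 1] (jdP b n) +
      ((n : ℝ[X]) - (m : ℝ[X])) * ((n : ℝ[X]) + (m : ℝ[X]) + C b + 1) * derivative^[m] (jdP b n) = 0 := by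
  induction m with
  | zero =>
    apply Polynomial.funext
    intro x
    have h := congrArg (eval (1 / 2 * (x - 1))) (jdQ_ode b n)
    simp only [derivative_mul, derivative_X, eval_add, eval_mul, eval_X, eval_C, eval_one,
      derivative_one, derivative_add, one_mul] at h
    simp only [Function.iterate_succ_apply', Function.iterate_zero, id, jdP, derivative_comp,
      derivative_mul, derivative_C, derivative_sub, derivative_X, derivative_one, eval_add,
      eval_mul, eval_sub, eval_pow, eval_X, eval_C, eval_one, eval_comp, eval_natCast, eval_zero,
      zero_mul, mul_zero, add_zero, zero_add, sub_zero, mul_one, CharP.cast_eq_zero, eval_ofNat]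
    linear_combination (-1) * h
  | succ m ih =>
    have h := congrArg derivative ih
    simp only [derivative_add, derivative_mul, derivative_sub, derivative_one, derivative_X_pow,
      derivative_X, derivative_C, derivative_natCast, derivative_zero, derivative_ofNat,
      ← Function.iterate_succ_apply' (⇑derivative)] at h
    push_cast at h ⊢
    simp only [Nat.cast_ofNat, map_ofNat] at h
    linear_combination h

noncomputable def jeW (b : ℝ) (m : ℕ) (x : ℝ) : ℝ := (1 - x) ^ m * (1 + x) ^ (b + (m : ℝ))

lemma jeW_int {b : ℝ} (hb : -1 < b) (m : ℕ) {f : ℝ → ℝ} (hf : Continuous f) :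
    IntervalIntegrable (fun x => f x * jeW b m x) volume (-1) 1 := by
  have hs : -1 < b + (m : ℝ) := by
    have : (0 : ℝ) ≤ m := Nat.cast_nonneg m
    linarith
  have h1 : IntervalIntegrable (fun y : ℝ => y ^ (b + (m : ℝ))) volume 0 2 :=
    intervalIntegral.intervalIntegrable_rpow' hs
  have h2 := h1.comp_add_left 1
  have e1 : (0 : ℝ) - 1 = -1 := by norm_num
  have e2 : (2 : ℝ) - 1 = 1 := by norm_num
  rw [e1, e2] at h2
  have h3 := h2.continuousOn_mul (g := fun x => f x * (1 - x) ^ m) (by fun_prop)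
  refine h3.congr ?_
  intro x _
  simp only [jeW]
  ring

noncomputable def jeIP (b : ℝ) (m : ℕ) (p q : Polynomial ℝ) : ℝ :=
  ∫ x in (-1 : ℝ)..1, p.eval x * q.eval x * jeW b m x

lemma jeIP_int {b : ℝ} (hb : -1 < b) (m : ℕ) (p q : Polynomial ℝ) :
    IntervalIntegrable (fun x => p.eval x * q.eval x * jeW b m x) volume (-1) 1 :=
  jeW_int hb m (by fun_prop)

lemma jeIP_comm (b : ℝ) (m : ℕ) (p q : Polynomial ℝ) : jeIP b m p q = jeIP b m q p := by
  unfold jeIP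
  congr 1
  ext x
  ring

lemma jeIP_sum {b : ℝ} (hb : -1 < b) (m : ℕ) {s : Finset ℕ} (v : ℕ → ℝ)
    (p : ℕ → Polynomial ℝ) (q : Polynomial ℝ) :
    jeIP b m (∑ i ∈ s, Polynomial.C (v i) * p i) q = ∑ i ∈ s, v i * jeIP b m (p i) q := by
  unfold jeIP
  simp only [← intervalIntegral.integral_const_mul]
  rw [← intervalIntegral.integral_finsetSum
    (fun i _ => (jeIP_int hb m (p i) q).const_mul (v i))]
  congr 1
  ext x
  simp only [Polynomial.eval_finsetSum, Polynomial.eval_mul, Polynomial.eval_C, Finset.sum_mul]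
  refine Finset.sum_congr rfl fun i _ => ?_
  ring

lemma jeIP_orth {b : ℝ} (hb : -1 < b) (m : ℕ) {s : Finset ℕ} (v : ℕ → ℝ)
    (p : ℕ → Polynomial ℝ) (h : ∀ i j, i ≠ j → jeIP b m (p i) (p j) = 0) :
    jeIP b m (∑ i ∈ s, Polynomial.C (v i) * p i) (∑ i ∈ s, Polynomial.C (v i) * p i) =
      ∑ i ∈ s, v i ^ 2 * jeIP b m (p i) (p i) := by
  rw [jeIP_sum hb]
  refine Finset.sum_congr rfl fun i hi => ?_
  rw [jeIP_comm, jeIP_sum hb, Finset.sum_eq_single i]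
  · ring
  · intro j _ hj
    rw [h j i hj, mul_zero]
  · intro h'; exact absurd hi h'

lemma jeIP_nonneg (b : ℝ) (m : ℕ) (p : Polynomial ℝ) : 0 ≤ jeIP b m p p := by
  unfold jeIP
  apply intervalIntegral.integral_nonneg (by norm_num)
  intro x hx
  unfold jeW
  have h1 : 0 ≤ 1 - x := by linarith [hx.2]
  have h2 : 0 ≤ 1 + x := by linarith [hx.1]
  have := mul_self_nonneg (p.eval x)
  positivity

open Polynomial in
lemma je_parts {b : ℝ} (hb : -1 < b) (m : ℕ) (l : ℝ) (q r : ℝ[X])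
    (hode : ∀ x : ℝ, (1 - x ^ 2) * (derivative (derivative q)).eval x +
      (b - (2 * (m : ℝ) + b + 2) * x) * (derivative q).eval x + l * q.eval x = 0) :
    jeIP b (m + 1) (derivative q) (derivative r) = l * jeIP b m q r := by
  have hm : (0 : ℝ) ≤ m := Nat.cast_nonneg m
  have hs : 0 < b + ((m + 1 : ℕ) : ℝ) := by push_cast; linarith
  have i1 := jeIP_int hb (m + 1) (derivative q) (derivative r)
  have i2 := (jeIP_int hb m q r).const_mul l
  have key := intervalIntegral.integral_eq_sub_of_hasDerivAt_of_le (a := (-1 : ℝ)) (b := 1)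
    (f := fun x => r.eval x * (derivative q).eval x * jeW b (m + 1) x)
    (f' := fun x => (derivative q).eval x * (derivative r).eval x * jeW b (m + 1) x -
      l * (q.eval x * r.eval x * jeW b m x)) (by norm_num)
    (by
      apply Continuous.continuousOn
      unfold jeW
      have : Continuous fun x : ℝ => (1 + x) ^ (b + ((m + 1 : ℕ) : ℝ)) :=
        (continuous_const.add continuous_id).rpow_const (fun _ => Or.inr hs.le)
      fun_prop)
    (by
      intro x hx
      have hx1 : 0 < 1 + x := by linarith [hx.1]
      have d1 := r.hasDerivAt x
      have d2 := (derivative q).hasDerivAt x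
      have d3 : HasDerivAt (fun x : ℝ => (1 - x) ^ (m + 1)) (-(((m : ℝ) + 1) * (1 - x) ^ m)) x := by
        have := ((hasDerivAt_id x).const_sub 1).pow (m + 1)
        convert! this using 1
        simp
      have d4 : HasDerivAt (fun x : ℝ => (1 + x) ^ (b + ((m + 1 : ℕ) : ℝ)))
          ((b + m + 1) * (1 + x) ^ (b + (m : ℝ))) x := by
        have := ((hasDerivAt_id x).const_add 1).rpow_const (p := b + ((m + 1 : ℕ) : ℝ))
          (Or.inl hx1.ne')
        convert! this using 1
        have e : b + ((m + 1 : ℕ) : ℝ) - 1 = b + m := by push_cast; ring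
        rw [e]
        push_cast
        simp only [id]
        ring
      have d := (d1.mul d2).mul (d3.mul d4)
      convert! d using 1
      unfold jeW
      have e : (1 + x) ^ (b + ((m + 1 : ℕ) : ℝ)) = (1 + x) ^ (b + (m : ℝ)) * (1 + x) := by
        rw [← Real.rpow_add_one hx1.ne']; congr 1; push_cast; ring
      simp only [Pi.mul_apply]
      rw [e, pow_succ]
      linear_combination (-(r.eval x * ((1 - x) ^ m * (1 + x) ^ (b + (m : ℝ))))) * hode x)
    (i1.sub i2)
  rw [intervalIntegral.integral_sub i1 i2, intervalIntegral.integral_const_mul] at key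
  have z : jeW b (m + 1) 1 = 0 ∧ jeW b (m + 1) (-1) = 0 := by
    unfold jeW
    constructor
    · simp
    · have : (1 : ℝ) + -1 = 0 := by norm_num
      rw [this, Real.zero_rpow hs.ne']; simp
  rw [z.1, z.2] at key
  unfold jeIP
  linarith

/-- product of eigenvalues -/
noncomputable def jeL (b : ℝ) (n m : ℕ) : ℝ :=
  (n.descFactorial m : ℝ) * ∏ i ∈ Finset.range m, ((n : ℝ) + i + b + 1)

open Polynomial in
lemma je_step {b : ℝ} (hb : -1 < b) (n m : ℕ) (r : ℝ[X]) :
    jeIP b (m + 1) (derivative^[m + 1] (jdP b n)) (derivative r) =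
      (((n : ℝ) - m) * (n + m + b + 1)) * jeIP b m (derivative^[m] (jdP b n)) r := by
  rw [Function.iterate_succ_apply']
  apply je_parts hb
  intro x
  have h := congrArg (eval x) (jdP_ode b n m)
  simp only [eval_add, eval_mul, eval_sub, eval_pow, eval_X, eval_C, eval_one, eval_natCast,
    eval_zero, eval_ofNat, Function.iterate_succ_apply'] at h
  linear_combination h

open Polynomial in
lemma je_all {b : ℝ} (hb : -1 < b) (n k m : ℕ) :
    jeIP b m (derivative^[m] (jdP b n)) (derivative^[m] (jdP b k)) =
      jeL b n m * jeIP b 0 (jdP b n) (jdP b k) := by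
  induction m with
  | zero => simp [jeL]
  | succ m ih =>
    rw [Function.iterate_succ_apply' _ _ (jdP b k), je_step hb, ih]
    unfold jeL
    rw [Nat.descFactorial_succ, Finset.prod_range_succ]
    rcases le_or_gt m n with h | h
    · push_cast [h]; ring
    · rw [(Nat.descFactorial_eq_zero_iff_lt).2 h]; simp

lemma je_orth0 {b : ℝ} (hb : -1 < b) (n k : ℕ) (h : n ≠ k) : jeIP b 0 (jdP b n) (jdP b k) = 0 := by
  have h1 := je_all hb n k 1
  have h2 := je_all hb k n 1
  rw [jeIP_comm, h1, jeIP_comm b 0 (jdP b k)] at h2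
  simp only [jeL, Nat.descFactorial_one, Finset.prod_range_one, Nat.cast_zero, add_zero] at h2
  have h3 : ((n : ℝ) - k) * (n + k + b + 1) * jeIP b 0 (jdP b n) (jdP b k) = 0 := by
    linear_combination h2
  have hne : (n : ℝ) - k ≠ 0 := sub_ne_zero.2 (by exact_mod_cast h)
  have hpos : (n : ℝ) + k + b + 1 ≠ 0 := by
    have : (0 : ℝ) ≤ n := Nat.cast_nonneg n
    have : (0 : ℝ) ≤ k := Nat.cast_nonneg k
    linarith
  simpa [hne, hpos] using h3

lemma jeL_nonneg {b : ℝ} (hb : -1 < b) (n m : ℕ) : 0 ≤ jeL b n m := by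
  unfold jeL
  apply mul_nonneg (by positivity)
  apply Finset.prod_nonneg
  intro i _
  have : (0 : ℝ) ≤ n := Nat.cast_nonneg n
  have : (0 : ℝ) ≤ i := Nat.cast_nonneg i
  linarith

lemma jeL_lower {b : ℝ} (hb : -1 < b) {n m N : ℕ} (hm : m ≤ N) (hn : N + 1 ≤ n) :
    ((N + 1).factorial : ℝ) / ((N - m + 1).factorial : ℝ) * (N : ℝ) ^ m ≤ jeL b n m := by
  unfold jeL
  apply mul_le_mul
  · rw [div_le_iff₀ (by positivity)]
    have h1 := Nat.factorial_mul_descFactorial (show m ≤ N + 1 by omega)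
    have h2 : (N + 1).descFactorial m ≤ n.descFactorial m := Nat.descFactorial_le m hn
    have e : N + 1 - m = N - m + 1 := by omega
    rw [e] at h1
    rw [← h1, mul_comm]
    exact_mod_cast Nat.mul_le_mul_right _ h2
  · rw [← Finset.card_range m, ← Finset.prod_const, Finset.card_range]
    apply Finset.prod_le_prod
    · intro i _; positivity
    · intro i _
      have h1 : ((N + 1 : ℕ) : ℝ) ≤ n := by exact_mod_cast hn
      push_cast at h1
      have : (0 : ℝ) ≤ i := Nat.cast_nonneg i
      linarith
  · positivity
  · positivity

lemma jg_eps {w f g : ℝ → ℝ} (hw : ∀ x ∈ Set.Ioc (-1 : ℝ) 1, 0 ≤ w x) (hwm : Measurable w)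
    (hf : Measurable f) (hg : Measurable g)
    (hfi : IntervalIntegrable (fun x => f x ^ 2 * w x) volume (-1) 1)
    (hgi : IntervalIntegrable (fun x => g x ^ 2 * w x) volume (-1) 1) {ε : ℝ} (hε : 0 < ε) :
    IntervalIntegrable (fun x => (f x + g x) ^ 2 * w x) volume (-1) 1 ∧
    ∫ x in (-1 : ℝ)..1, (f x + g x) ^ 2 * w x ≤ (1 + ε) * (∫ x in (-1 : ℝ)..1, f x ^ 2 * w x) +
      (1 + 1 / ε) * ∫ x in (-1 : ℝ)..1, g x ^ 2 * w x := by
  have h11 : (-1 : ℝ) ≤ 1 := by norm_num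
  have hb := (hfi.const_mul (1 + ε)).add (hgi.const_mul (1 + 1 / ε))
  have pt : ∀ x ∈ Set.Ioc (-1 : ℝ) 1, (f x + g x) ^ 2 * w x ≤
      (1 + ε) * (f x ^ 2 * w x) + (1 + 1 / ε) * (g x ^ 2 * w x) := by
    intro x hx
    have h1 : (f x + g x) ^ 2 ≤ (1 + ε) * f x ^ 2 + (1 + 1 / ε) * g x ^ 2 := by
      have e : (1 + ε) * f x ^ 2 + (1 + 1 / ε) * g x ^ 2 - (f x + g x) ^ 2 =
          (ε * f x - g x) ^ 2 / ε := by field_simp; ring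
      have : 0 ≤ (ε * f x - g x) ^ 2 / ε := by positivity
      linarith
    have := mul_le_mul_of_nonneg_right h1 (hw x hx)
    linarith
  have hi : IntervalIntegrable (fun x => (f x + g x) ^ 2 * w x) volume (-1) 1 := by
    rw [intervalIntegrable_iff_integrableOn_Ioc_of_le h11] at hb ⊢
    refine Integrable.mono' hb ?_ ?_
    · exact (((hf.add hg).pow_const 2).mul hwm).aestronglyMeasurable
    · rw [ae_restrict_iff' measurableSet_Ioc]
      refine Filter.Eventually.of_forall fun x hx => ?_
      rw [Real.norm_of_nonneg (mul_nonneg (sq_nonneg _) (hw x hx))]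
      exact pt x hx
  refine ⟨hi, ?_⟩
  rw [← intervalIntegral.integral_const_mul, ← intervalIntegral.integral_const_mul,
    ← intervalIntegral.integral_add (hfi.const_mul _) (hgi.const_mul _)]
  refine intervalIntegral.integral_mono_on_of_le_Ioo h11 hi hb ?_
  intro x hx
  exact pt x ⟨hx.1, hx.2.le⟩

lemma jg_iter (p : Polynomial ℝ) (m : ℕ) (x : ℝ) :
    iteratedDeriv m (fun x => p.eval x) x = (Polynomial.derivative^[m] p).eval x := by
  induction m generalizing x with
  | zero => simp
  | succ m ih =>
    rw [iteratedDeriv_succ, Function.iterate_succ_apply', funext ih, Polynomial.deriv]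

lemma jeW_nonneg (b : ℝ) (m : ℕ) : ∀ x ∈ Set.Ioc (-1 : ℝ) 1, 0 ≤ jeW b m x := by
  intro x hx
  unfold jeW
  have h1 : 0 ≤ 1 - x := by linarith [hx.2]
  have h2 : 0 ≤ 1 + x := by linarith [hx.1]
  positivity

lemma jeW_meas (b : ℝ) (m : ℕ) : Measurable (jeW b m) := by
  unfold jeW
  fun_prop

lemma jg_polysq (b : ℝ) (m : ℕ) (p : Polynomial ℝ) :
    jeIP b m p p = ∫ x in (-1 : ℝ)..1, (p.eval x) ^ 2 * jeW b m x := by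
  unfold jeIP
  simp only [sq]

lemma jg_polyint {b : ℝ} (hb : -1 < b) (m : ℕ) (p : Polynomial ℝ) :
    IntervalIntegrable (fun x => (p.eval x) ^ 2 * jeW b m x) volume (-1) 1 :=
  jeW_int hb m (by fun_prop)

/-- Abstract projection estimate. -/
lemma jg_main {b : ℝ} (hb : -1 < b) {m N : ℕ} (hmN : m ≤ N) (hN : 1 ≤ N) (v : ℕ → ℝ)
    {D E : ℝ → ℝ} (hD : Measurable D) (hE : Measurable E)
    (hDi : IntervalIntegrable (fun x => D x ^ 2 * jeW b 0 x) volume (-1) 1)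
    (hEi : IntervalIntegrable (fun x => E x ^ 2 * jeW b m x) volume (-1) 1)
    (hDc : Tendsto (fun M : ℕ => ∫ x in (-1 : ℝ)..1,
      ((∑ n ∈ Finset.range (M + 1), Polynomial.C (v n) * jdP b n).eval x - D x) ^ 2 * jeW b 0 x)
      atTop (nhds 0))
    (hEc : Tendsto (fun M : ℕ => ∫ x in (-1 : ℝ)..1,
      ((∑ n ∈ Finset.range (M + 1), Polynomial.C ((-1) ^ m * v n) *
        Polynomial.derivative^[m] (jdP b n)).eval x - E x) ^ 2 * jeW b m x)
      atTop (nhds 0)) :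
    IntervalIntegrable (fun x => ((∑ n ∈ Finset.range (N + 1), Polynomial.C (v n) * jdP b n).eval x
      - D x) ^ 2 * jeW b 0 x) volume (-1) 1 ∧
    ((N + 1).factorial : ℝ) / ((N - m + 1).factorial : ℝ) * (N : ℝ) ^ m *
      (∫ x in (-1 : ℝ)..1, ((∑ n ∈ Finset.range (N + 1), Polynomial.C (v n) * jdP b n).eval x
        - D x) ^ 2 * jeW b 0 x) ≤ ∫ x in (-1 : ℝ)..1, E x ^ 2 * jeW b m x := by
  set S : ℕ → Polynomial ℝ := fun M => ∑ n ∈ Finset.range (M + 1), Polynomial.C (v n) * jdP b n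
    with hS
  set R : ℕ → Polynomial ℝ := fun M => ∑ n ∈ Finset.range (M + 1), Polynomial.C ((-1) ^ m * v n) *
        Polynomial.derivative^[m] (jdP b n) with hR
  set K : ℝ := ((N + 1).factorial : ℝ) / ((N - m + 1).factorial : ℝ) * (N : ℝ) ^ m with hK
  have hK0 : 0 ≤ K := by positivity
  have subi : ∀ (k : ℕ) (p : Polynomial ℝ) (F : ℝ → ℝ), Measurable F →
      IntervalIntegrable (fun x => F x ^ 2 * jeW b k x) volume (-1) 1 →
      IntervalIntegrable (fun x => (p.eval x - F x) ^ 2 * jeW b k x) volume (-1) 1 := by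
    intro k p F hF hFi
    have := (jg_eps (jeW_nonneg b k) (jeW_meas b k) (f := fun x => p.eval x) (g := fun x => - F x)
      p.continuous.measurable hF.neg (jg_polyint hb k p) (by simpa using hFi) one_pos).1
    simpa [sub_eq_add_neg] using this
  have iD : ∀ M, IntervalIntegrable (fun x => ((S M).eval x - D x) ^ 2 * jeW b 0 x)
      volume (-1) 1 := fun M => subi 0 (S M) D hD hDi
  have iE : ∀ M, IntervalIntegrable (fun x => ((R M).eval x - E x) ^ 2 * jeW b m x)
      volume (-1) 1 := fun M => subi m (R M) E hE hEi
  refine ⟨iD N, ?_⟩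
  have hBT : ∀ M, N ≤ M → K * jeIP b 0 (S M - S N) (S M - S N) ≤ jeIP b m (R M) (R M) := by
    intro M hM
    have hsub : Finset.range (N + 1) ⊆ Finset.range (M + 1) :=
      Finset.range_subset_range.2 (by omega)
    have e : S M - S N = ∑ n ∈ Finset.range (M + 1) \ Finset.range (N + 1),
        Polynomial.C (v n) * jdP b n := by
      rw [sub_eq_iff_eq_add]
      exact (Finset.sum_sdiff hsub).symm
    rw [e, jeIP_orth hb 0 v (jdP b) (je_orth0 hb)]
    simp only [hR]
    rw [jeIP_orth hb m (fun n => (-1) ^ m * v n) (fun n => Polynomial.derivative^[m] (jdP b n))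
      (fun i j hij => by rw [je_all hb, je_orth0 hb i j hij, mul_zero])]
    have nn : ∀ n, 0 ≤ jeIP b 0 (jdP b n) (jdP b n) := fun n => jeIP_nonneg b 0 _
    have hterm : ∀ n, ((-1) ^ m * v n) ^ 2 *
        jeIP b m (Polynomial.derivative^[m] (jdP b n)) (Polynomial.derivative^[m] (jdP b n)) =
        v n ^ 2 * (jeL b n m * jeIP b 0 (jdP b n) (jdP b n)) := by
      intro n
      rw [je_all hb, mul_pow, ← pow_mul, mul_comm m 2, pow_mul]
      norm_num
    simp only [hterm]
    rw [Finset.mul_sum]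
    calc _ ≤ ∑ n ∈ Finset.range (M + 1) \ Finset.range (N + 1),
          v n ^ 2 * (jeL b n m * jeIP b 0 (jdP b n) (jdP b n)) := by
          apply Finset.sum_le_sum
          intro n hn
          have hn' : N + 1 ≤ n := by
            simp only [Finset.mem_sdiff, Finset.mem_range] at hn; omega
          have h1 := jeL_lower hb hmN hn'
          have h2 : 0 ≤ v n ^ 2 * jeIP b 0 (jdP b n) (jdP b n) := mul_nonneg (sq_nonneg _) (nn n)
          have := mul_le_mul_of_nonneg_right h1 h2
          rw [hK]
          linarith
      _ ≤ _ := by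
          apply Finset.sum_le_sum_of_subset_of_nonneg Finset.sdiff_subset
          intro n _ _
          exact mul_nonneg (sq_nonneg _) (mul_nonneg (jeL_nonneg hb n m) (nn n))
  set A := ∫ x in (-1 : ℝ)..1, ((S N).eval x - D x) ^ 2 * jeW b 0 x with hA
  set T := ∫ x in (-1 : ℝ)..1, E x ^ 2 * jeW b m x with hT
  have step : ∀ ε : ℝ, 0 < ε → K * A ≤ (1 + ε) * ((1 + ε) * T) := by
    intro ε hε
    have lim : Tendsto (fun M : ℕ => (1 + ε) * ((1 + ε) * T + (1 + 1 / ε) * ∫ x in (-1 : ℝ)..1,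
        ((R M).eval x - E x) ^ 2 * jeW b m x) + K * ((1 + 1 / ε) * ∫ x in (-1 : ℝ)..1,
        ((S M).eval x - D x) ^ 2 * jeW b 0 x)) atTop
        (nhds ((1 + ε) * ((1 + ε) * T + (1 + 1 / ε) * 0) + K * ((1 + 1 / ε) * 0))) :=
      (((hEc.const_mul _).const_add _).const_mul _).add ((hDc.const_mul _).const_mul _)
    have e0 : (1 + ε) * ((1 + ε) * T + (1 + 1 / ε) * 0) + K * ((1 + 1 / ε) * 0) =
      (1 + ε) * ((1 + ε) * T) := by ring
    rw [e0] at lim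
    refine ge_of_tendsto lim ?_
    filter_upwards [eventually_ge_atTop N] with M hM
    have q1 := (jg_eps (jeW_nonneg b 0) (jeW_meas b 0) (f := fun x => (S N - S M).eval x)
      (g := fun x => (S M).eval x - D x) (S N - S M).continuous.measurable
      ((S M).continuous.measurable.sub hD) (jg_polyint hb 0 _) (iD M) hε).2
    have q2 := (jg_eps (jeW_nonneg b m) (jeW_meas b m) (f := E)
      (g := fun x => (R M).eval x - E x) hE
      ((R M).continuous.measurable.sub hE) hEi (iE M) hε).2
    have q3 := hBT M hM
    rw [jg_polysq, jg_polysq] at q3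
    simp only [Polynomial.eval_sub, sub_add_sub_cancel, add_sub_cancel] at q1 q2 q3
    have e3 : ∀ x, ((S M).eval x - (S N).eval x) ^ 2 = ((S N).eval x - (S M).eval x) ^ 2 :=
      fun x => by ring
    simp only [e3] at q3
    have q4 := mul_le_mul_of_nonneg_left q1 hK0
    have q5 := mul_le_mul_of_nonneg_left (q3.trans q2) (show 0 ≤ 1 + ε by linarith)
    linarith
  have lim2 : Tendsto (fun ε : ℝ => (1 + ε) * ((1 + ε) * T)) (nhdsWithin 0 (Set.Ioi 0)) (nhds T) := by
    have : Continuous fun ε : ℝ => (1 + ε) * ((1 + ε) * T) := by fun_prop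
    have h := this.tendsto 0
    simp only [add_zero, one_mul] at h
    exact h.mono_left nhdsWithin_le_nhds
  refine ge_of_tendsto lim2 ?_
  filter_upwards [self_mem_nhdsWithin] with ε hε
  exact step ε hε

lemma jh_meas (α : ℝ) (u : ℝ → ℝ) : Measurable (DplusC α u) := by
  unfold DplusC Dplus
  simp only [iteratedDeriv_succ]
  exact (measurable_deriv _).const_mul _

/-- Theorem 4.2, estimate (4.43): projection error for
`(α,β) ∈ ⁺Υ₃` via the fractional derivative expansion. -/
theorem stmt14 (α β : ℝ) (hα : 0 < α) (hβ1 : -α - 1 < β) (hβ2 : β < -1)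
    (hβ3 : ∀ j : ℕ, β ≠ -(j : ℝ)) (m N : ℕ) (hmN : m ≤ N) (hN : 1 ≤ N)
    (u : ℝ → ℝ)
    (hmemα : IntegrableOn (fun x => (DplusC α u x) ^ 2 * (1 + x) ^ (α + β))
      (Set.Ioo (-1 : ℝ) 1))
    (vhat : ℕ → ℝ)
    (hvhat : ∀ n : ℕ, vhat n = (1 / gammaJ 0 (α + β) n) *
      ∫ x in (-1 : ℝ)..1, DplusC α u x * jacobiP 0 (α + β) n x * (1 + x) ^ (α + β))
    (hconvα : Filter.Tendsto (fun M : ℕ => ∫ x in (-1 : ℝ)..1,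
        ((∑ n ∈ Finset.range (M + 1), vhat n * jacobiP 0 (α + β) n x) - DplusC α u x) ^ 2 *
          (1 + x) ^ (α + β)) Filter.atTop (nhds 0))
    (Dum : ℝ → ℝ)
    (hDum : ∀ x : ℝ, Dum x = (-1 : ℝ) ^ m * iteratedDeriv m (DplusC α u) x)
    (hmemm : IntegrableOn
      (fun x => (Dum x) ^ 2 * ((1 - x) ^ (m : ℝ) * (1 + x) ^ (α + β + (m : ℝ))))
      (Set.Ioo (-1 : ℝ) 1))
    (hconvm : Filter.Tendsto (fun M : ℕ => ∫ x in (-1 : ℝ)..1,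
        ((∑ n ∈ Finset.range (M + 1),
            vhat n * ((-1 : ℝ) ^ m * iteratedDeriv m (jacobiP 0 (α + β) n) x)) - Dum x) ^ 2 *
          ((1 - x) ^ (m : ℝ) * (1 + x) ^ (α + β + (m : ℝ)))) Filter.atTop (nhds 0)) :
    Real.sqrt (∫ x in (-1 : ℝ)..1,
        (DplusC α
            (fun y => (∑ n ∈ Finset.range (N + 1),
                (Nat.factorial n : ℝ) * vhat n / Real.Gamma ((n : ℝ) + α + 1) *
                  ((1 - y) ^ α * jacobiP α β n y)) - u y) x) ^ 2 *
          (1 + x) ^ (α + β)) ≤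
      (N : ℝ) ^ (-(m : ℝ) / 2) *
        Real.sqrt ((Nat.factorial (N - m + 1) : ℝ) / (Nat.factorial (N + 1) : ℝ)) *
        Real.sqrt (∫ x in (-1 : ℝ)..1,
          (Dum x) ^ 2 * ((1 - x) ^ (m : ℝ) * (1 + x) ^ (α + β + (m : ℝ)))) := by
  have hb : -1 < α + β := by linarith
  have h11 : (-1 : ℝ) ≤ 1 := by norm_num
  have w0 : ∀ x, (1 + x) ^ (α + β) = jeW (α + β) 0 x := by intro x; simp [jeW]
  have wm : ∀ x, (1 - x) ^ (m : ℝ) * (1 + x) ^ (α + β + (m : ℝ)) = jeW (α + β) m x := by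
    intro x; simp [jeW]
  have hDm : Measurable (DplusC α u) := jh_meas α u
  have hEm : Measurable Dum := by
    rw [funext hDum]
    refine Measurable.const_mul ?_ _
    cases m with
    | zero => simpa using hDm
    | succ m => rw [iteratedDeriv_succ]; exact measurable_deriv _
  simp only [w0] at hmemα hconvα ⊢
  simp only [wm] at hmemm hconvm ⊢
  have evS : ∀ (M : ℕ) (x : ℝ), (∑ n ∈ Finset.range (M + 1),
      Polynomial.C (vhat n) * jdP (α + β) n).eval x =
      ∑ n ∈ Finset.range (M + 1), vhat n * jacobiP 0 (α + β) n x := by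
    intro M x
    simp [Polynomial.eval_finsetSum, jdP_eval]
  have evR : ∀ (M : ℕ) (x : ℝ), (∑ n ∈ Finset.range (M + 1), Polynomial.C ((-1) ^ m * vhat n) *
        Polynomial.derivative^[m] (jdP (α + β) n)).eval x =
      ∑ n ∈ Finset.range (M + 1),
        vhat n * ((-1 : ℝ) ^ m * iteratedDeriv m (jacobiP 0 (α + β) n) x) := by
    intro M x
    rw [Polynomial.eval_finsetSum]
    refine Finset.sum_congr rfl fun n _ => ?_
    have : jacobiP 0 (α + β) n = fun x => (jdP (α + β) n).eval x :=
      funext fun x => (jdP_eval _ _ x).symm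
    rw [Polynomial.eval_mul, Polynomial.eval_C, this, jg_iter]
    ring
  obtain ⟨hi, hle⟩ := jg_main hb hmN hN vhat hDm hEm
    ((intervalIntegrable_iff_integrableOn_Ioo_of_le h11).2 hmemα)
    ((intervalIntegrable_iff_integrableOn_Ioo_of_le h11).2 hmemm)
    (by simp only [evS]; exact hconvα) (by simp only [evR]; exact hconvm)
  simp only [evS] at hi hle
  obtain ⟨C, hC, hC2⟩ := jc_main (β := β) hα N u vhat
  set T := ∫ x in (-1 : ℝ)..1, Dum x ^ 2 * jeW (α + β) m x
  have hA : (∫ x in (-1 : ℝ)..1,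
        (DplusC α
            (fun y => (∑ n ∈ Finset.range (N + 1),
                (Nat.factorial n : ℝ) * vhat n / Real.Gamma ((n : ℝ) + α + 1) *
                  ((1 - y) ^ α * jacobiP α β n y)) - u y) x) ^ 2 *
          jeW (α + β) 0 x) ≤ ∫ x in (-1 : ℝ)..1,
        ((∑ n ∈ Finset.range (N + 1), vhat n * jacobiP 0 (α + β) n x) - DplusC α u x) ^ 2 *
          jeW (α + β) 0 x := by
    rw [intervalIntegral.integral_of_le h11, intervalIntegral.integral_of_le h11]
    rw [intervalIntegrable_iff_integrableOn_Ioc_of_le h11] at hi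
    refine integral_mono_of_nonneg ?_ hi ?_
    · refine (ae_restrict_iff' measurableSet_Ioc).2 (Filter.Eventually.of_forall fun x hx => ?_)
      exact mul_nonneg (sq_nonneg _) (jeW_nonneg _ _ x hx)
    · refine (ae_restrict_iff' measurableSet_Ioc).2 ?_
      have hnull : ∀ᵐ x : ℝ, x ∉ C ∪ {1} :=
        measure_eq_zero_iff_ae_notMem.1 ((hC.union (Set.countable_singleton 1)).measure_zero volume)
      filter_upwards [hnull] with x hx hx2
      have hx1 : x ≠ 1 := fun h => hx (Or.inr h)
      exact mul_le_mul_of_nonneg_right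
        (hC2 x ⟨hx2.1, lt_of_le_of_ne hx2.2 hx1⟩ (fun h => hx (Or.inl h))) (jeW_nonneg _ _ x hx2)
  have hNpos : (0 : ℝ) < N := by exact_mod_cast hN
  have hKT : (∫ x in (-1 : ℝ)..1,
        ((∑ n ∈ Finset.range (N + 1), vhat n * jacobiP 0 (α + β) n x) - DplusC α u x) ^ 2 *
          jeW (α + β) 0 x) ≤ ((N : ℝ) ^ m)⁻¹ * ((Nat.factorial (N - m + 1) : ℝ) /
            (Nat.factorial (N + 1) : ℝ)) * T := by
    have hp : (0 : ℝ) < (N : ℝ) ^ m := by positivity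
    have hp1 : (0 : ℝ) < ((N + 1).factorial : ℝ) := by positivity
    have hp2 : (0 : ℝ) < ((N - m + 1).factorial : ℝ) := by positivity
    have hc : 0 ≤ ((N : ℝ) ^ m)⁻¹ * ((Nat.factorial (N - m + 1) : ℝ) /
            (Nat.factorial (N + 1) : ℝ)) := by positivity
    have := mul_le_mul_of_nonneg_left hle hc
    refine le_trans (le_of_eq ?_) this
    field_simp
  refine (Real.sqrt_le_sqrt (hA.trans hKT)).trans (le_of_eq ?_)
  rw [Real.sqrt_mul (by positivity), Real.sqrt_mul (by positivity)]
  congr 2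
  rw [Real.sqrt_eq_rpow, ← Real.rpow_natCast, ← Real.rpow_neg hNpos.le, ← Real.rpow_mul hNpos.le]
  congr 1
  ring
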